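/- Ascent property of TMA: let (p_t) be the TMA iterates for a fixed policy π and an s-rectangular ambiguity set. Then (i) for every t, every state s and every y ∈ 𝒫_s: β_t ⟨ĝ^{π,p_t}_s, y − p_{t+1,s}⟩ + B(p_{t+1,s}, p_{t,s}) ≤ B(y, p_{t,s}) − B(y, p_{t+1,s}); and (ii) for every t ≥ 0 and every initial distribution ρ ∈ Δ^S: J_ρ(π, p_t) ≤ J_ρ(π, p_{t+1}). -/

import Mathlib

open scoped BigOperators

noncomputable section

namespace RMDPStmt

variable {S A : ℕ}

/-- `p` is a transition kernel: each `p s a` lies in the probability simplex `Δ^S`. -/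
def IsKernel (p : Fin S → Fin A → Fin S → ℝ) : Prop :=
  ∀ s a, p s a ∈ stdSimplex ℝ (Fin S)

/-- `π` is a stationary randomized policy: each `π s` lies in the simplex `Δ^A`. -/
def IsPolicy (π : Fin S → Fin A → ℝ) : Prop :=
  ∀ s, π s ∈ stdSimplex ℝ (Fin A)

/-- The state-to-state matrix `P^π`. -/
def Pmat (π : Fin S → Fin A → ℝ) (p : Fin S → Fin A → Fin S → ℝ) :
    Matrix (Fin S) (Fin S) ℝ :=
  Matrix.of fun s s' => ∑ a, π s a * p s a s'

/-- The expected one-step cost vector `c^π`. -/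
def cvec (c : Fin S → Fin A → Fin S → ℝ) (π : Fin S → Fin A → ℝ)
    (p : Fin S → Fin A → Fin S → ℝ) : Fin S → ℝ :=
  fun s => ∑ a, π s a * ∑ s', p s a s' * c s a s'

/-- Value function `v^{π,p}` as a discounted series. -/
def value (γ : ℝ) (c : Fin S → Fin A → Fin S → ℝ) (π : Fin S → Fin A → ℝ)
    (p : Fin S → Fin A → Fin S → ℝ) : Fin S → ℝ :=
  fun s => ∑' t : ℕ, γ ^ t * ((Pmat π p ^ t).mulVec (cvec c π p)) s

/-- The return `J_ρ(π,p)`. -/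
def J (γ : ℝ) (c : Fin S → Fin A → Fin S → ℝ) (ρ : Fin S → ℝ)
    (π : Fin S → Fin A → ℝ) (p : Fin S → Fin A → Fin S → ℝ) : ℝ :=
  ∑ s, ρ s * value γ c π p s

/-- The action-value function `q^{π,p}`. -/
def qval (γ : ℝ) (c : Fin S → Fin A → Fin S → ℝ) (π : Fin S → Fin A → ℝ)
    (p : Fin S → Fin A → Fin S → ℝ) : Fin S → Fin A → ℝ :=
  fun s a => ∑ s', p s a s' * (c s a s' + γ * value γ c π p s')

/-- The discounted state occupancy measure `d^{π,p}_ρ`. -/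
def occ (γ : ℝ) (ρ : Fin S → ℝ) (π : Fin S → Fin A → ℝ)
    (p : Fin S → Fin A → Fin S → ℝ) : Fin S → ℝ :=
  fun s' => (1 - γ) * ∑' t : ℕ, γ ^ t * ∑ s, ρ s * (Pmat π p ^ t) s s'

/-- Bregman divergence generated by `h`. -/
def breg {E : Type*} [NormedAddCommGroup E] [NormedSpace ℝ E]
    (h : E → ℝ) (x y : E) : ℝ :=
  h x - h y - fderiv ℝ h y (x - y)

/-- Weighted Bregman divergence `B_μ`. -/
def bregW {E : Type*} [NormedAddCommGroup E] [NormedSpace ℝ E]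
    (μ : Fin S → ℝ) (h : E → ℝ) (x y : Fin S → E) : ℝ :=
  ∑ s, μ s * breg h (x s) (y s)

/-- Inner product of two action-indexed vectors. -/
def dotA (u v : Fin A → ℝ) : ℝ := ∑ a, u a * v a

/-- Inner product of two action-by-state arrays. -/
def dotAS (u v : Fin A → Fin S → ℝ) : ℝ := ∑ a, ∑ s', u a s' * v a s'

/-- The robust objective `Φ(π) = sup_{p ∈ Amb} J_ρ(π,p)`. -/
def Phi (γ : ℝ) (c : Fin S → Fin A → Fin S → ℝ) (ρ : Fin S → ℝ)
    (Amb : Set (Fin S → Fin A → Fin S → ℝ)) (π : Fin S → Fin A → ℝ) : ℝ :=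
  sSup ((fun p => J γ c ρ π p) '' Amb)

/-- The distribution mismatch coefficient
`M = sup_{π ∈ Π, p ∈ Amb} max_s d^{π,p}_ρ(s)/ρ_s`. -/
def mismatch (γ : ℝ) (ρ : Fin S → ℝ)
    (Amb : Set (Fin S → Fin A → Fin S → ℝ)) : ℝ :=
  sSup {x : ℝ | ∃ (π : Fin S → Fin A → ℝ) (p : Fin S → Fin A → Fin S → ℝ),
    IsPolicy π ∧ p ∈ Amb ∧ ∃ s, x = occ γ ρ π p s / ρ s}


/-- The array `ĝ^{π,p}_s ∈ ℝ^{A×S}` with `(ĝ^{π,p}_s)_{as'} = π_{sa}(c_{sas'} + γ v^{π,p}_{s'})`. -/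
def ghat {S A : ℕ} (γ : ℝ) (c : Fin S → Fin A → Fin S → ℝ)
    (π : Fin S → Fin A → ℝ) (p : Fin S → Fin A → Fin S → ℝ) (s : Fin S) :
    Fin A → Fin S → ℝ :=
  fun a s' => π s a * (c s a s' + γ * value γ c π p s')

section Bregman

variable {E : Type*} [NormedAddCommGroup E] [NormedSpace ℝ E] {h : E → ℝ}

@[simp]
lemma breg_self (h : E → ℝ) (x : E) : breg h x x = 0 := by
  simp [breg]

/-- The gradient inequality for a convex function, in terms of its Bregman divergence. -/
lemma breg_nonneg (hconv : ConvexOn ℝ Set.univ h) {y : E} (hy : DifferentiableAt ℝ h y) (x : E) :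
    0 ≤ breg h x y := by
  have hline : ConvexOn ℝ Set.univ (h ∘ AffineMap.lineMap (k := ℝ) y x) :=
    hconv.comp_affineMap _
  have hy' : HasFDerivAt h (fderiv ℝ h y) (AffineMap.lineMap (k := ℝ) y x (0 : ℝ)) := by
    simpa using hy.hasFDerivAt
  have hd := hy'.comp_hasDerivAt (0 : ℝ) AffineMap.hasDerivAt_lineMap
  have hle := hline.le_slope_of_hasDerivAt (Set.mem_univ 0) (Set.mem_univ 1) one_pos hd
  simp only [slope_def_field, Function.comp_apply, AffineMap.lineMap_apply_one,
    AffineMap.lineMap_apply_zero, sub_zero, div_one] at hle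
  unfold breg
  linarith

/-- The three-point inequality for a Bregman proximal step. -/
lemma breg_three_point (hh : Differentiable ℝ h) {K : Set E} (hK : Convex ℝ K) (l : E →L[ℝ] ℝ)
    {x y z : E} (hx : x ∈ K) (hy : y ∈ K)
    (hmax : ∀ u ∈ K, l u - breg h u z ≤ l x - breg h x z) :
    l (y - x) + breg h x z ≤ breg h y z - breg h y x := by
  have hd : HasFDerivAt (fun u => l u - breg h u z)
      (l - (fderiv ℝ h x - fderiv ℝ h z)) x :=
    l.hasFDerivAt.sub (((hh x).hasFDerivAt.sub_const (h z)).sub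
      ((fderiv ℝ h z).hasFDerivAt.comp x ((hasFDerivAt_id x).sub_const z)))
  have hle := IsLocalMaxOn.hasFDerivWithinAt_nonpos (IsMaxOn.localize hmax)
    hd.hasFDerivWithinAt (sub_mem_posTangentConeAt_of_segment_subset (hK.segment_subset hx hy))
  simp only [sub_apply, map_sub] at hle
  simp only [breg, map_sub]
  linarith

end Bregman

/-- `dotAS g` as a continuous linear functional. -/
def dotASL (g : Fin A → Fin S → ℝ) : (Fin A → Fin S → ℝ) →L[ℝ] ℝ :=
  LinearMap.toContinuousLinearMap
    { toFun := dotAS g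
      map_add' := fun x y => by simp [dotAS, mul_add, Finset.sum_add_distrib]
      map_smul' := fun r x => by simp [dotAS, Finset.mul_sum, mul_left_comm] }

@[simp]
lemma dotASL_apply (g x : Fin A → Fin S → ℝ) : dotASL g x = dotAS g x := rfl

section Value

variable {γ : ℝ} {c : Fin S → Fin A → Fin S → ℝ} {π : Fin S → Fin A → ℝ}
  {p : Fin S → Fin A → Fin S → ℝ}

lemma Pmat_mem_rowStochastic (hπ : IsPolicy π) (hp : IsKernel p) :
    Pmat π p ∈ Matrix.rowStochastic ℝ (Fin S) := by
  refine Matrix.mem_rowStochastic_iff_sum.2 ⟨fun s s' => ?_, fun s => ?_⟩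
  · rw [Pmat, Matrix.of_apply]
    exact Finset.sum_nonneg fun a _ => mul_nonneg ((hπ s).1 a) ((hp s a).1 s')
  · simp only [Pmat, Matrix.of_apply]
    rw [Finset.sum_comm]
    simp [← Finset.mul_sum, (hp s _).2, (hπ s).2]

lemma abs_mulVec_le_of_mem_rowStochastic {n : Type*} [Fintype n] [DecidableEq n]
    {M : Matrix n n ℝ} (hM : M ∈ Matrix.rowStochastic ℝ n) {v : n → ℝ} {C : ℝ}
    (hv : ∀ i, |v i| ≤ C) (i : n) : |M.mulVec v i| ≤ C :=
  calc |∑ j, M i j * v j| ≤ ∑ j, |M i j * v j| := Finset.abs_sum_le_sum_abs _ _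
    _ ≤ ∑ j, M i j * C := Finset.sum_le_sum fun j _ => by
      rw [abs_mul, abs_of_nonneg (Matrix.nonneg_of_mem_rowStochastic hM)]
      exact mul_le_mul_of_nonneg_left (hv j) (Matrix.nonneg_of_mem_rowStochastic hM)
    _ = C := by rw [← Finset.sum_mul, Matrix.sum_row_of_mem_rowStochastic hM, one_mul]

lemma summable_value (hγ : γ ∈ Set.Ioo (0 : ℝ) 1) (hπ : IsPolicy π) (hp : IsKernel p)
    (s : Fin S) :
    Summable fun t : ℕ => γ ^ t * ((Pmat π p ^ t).mulVec (cvec c π p)) s := by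
  refine Summable.of_norm_bounded (g := fun t => γ ^ t * ∑ i, |cvec c π p i|)
    ((summable_geometric_of_lt_one hγ.1.le hγ.2).mul_right _) fun t => ?_
  rw [Real.norm_eq_abs, abs_mul, abs_of_nonneg (pow_nonneg hγ.1.le t)]
  refine mul_le_mul_of_nonneg_left ?_ (pow_nonneg hγ.1.le t)
  exact abs_mulVec_le_of_mem_rowStochastic (pow_mem (Pmat_mem_rowStochastic hπ hp) t)
    (fun i => Finset.single_le_sum (f := fun i => |cvec c π p i|)
      (fun i _ => abs_nonneg _) (Finset.mem_univ i)) s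

/-- The Bellman equation for `value`. -/
lemma value_eq_cvec_add (hγ : γ ∈ Set.Ioo (0 : ℝ) 1) (hπ : IsPolicy π) (hp : IsKernel p)
    (s : Fin S) :
    value γ c π p s = cvec c π p s + γ * (Pmat π p).mulVec (value γ c π p) s := by
  have hsum := summable_value (c := c) hγ hπ hp
  have hshift : HasSum (fun t : ℕ => γ ^ (t + 1) * (Pmat π p ^ (t + 1)).mulVec (cvec c π p) s)
      (γ * (Pmat π p).mulVec (value γ c π p) s) := by
    have hsum' := (hasSum_sum fun s' (_ : s' ∈ Finset.univ) =>
      (hsum s').hasSum.mul_left (Pmat π p s s')).mul_left γ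
    refine (congrArg (HasSum · _) (funext fun t => ?_)).mpr hsum'
    rw [pow_succ' (Pmat π p), ← Matrix.mulVec_mulVec, Matrix.mulVec, dotProduct, Finset.mul_sum,
      Finset.mul_sum]
    exact Finset.sum_congr rfl fun s' _ => by ring
  rw [value, (hsum s).tsum_eq_zero_add, hshift.tsum_eq]
  simp

lemma dotAS_ghat (p q : Fin S → Fin A → Fin S → ℝ) (s : Fin S) :
    dotAS (ghat γ c π p s) (q s) =
      cvec c π q s + γ * (Pmat π q).mulVec (value γ c π p) s := by
  simp only [dotAS, ghat, cvec, Pmat, Matrix.mulVec, dotProduct, Matrix.of_apply,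
    Finset.mul_sum, Finset.sum_mul]
  rw [Finset.sum_comm (s := (Finset.univ : Finset (Fin S))), ← Finset.sum_add_distrib]
  refine Finset.sum_congr rfl fun a _ => ?_
  rw [← Finset.sum_add_distrib]
  exact Finset.sum_congr rfl fun s' _ => by ring

/-- A vector dominating its discounted image under a stochastic matrix is nonnegative. -/
lemma nonneg_of_mul_mulVec_le {n : Type*} [Fintype n] [DecidableEq n] {M : Matrix n n ℝ}
    (hM : M ∈ Matrix.rowStochastic ℝ n) (hγ : γ ∈ Set.Ioo (0 : ℝ) 1) {w : n → ℝ}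
    (hw : ∀ i, γ * M.mulVec w i ≤ w i) (i : n) : 0 ≤ w i := by
  have : Nonempty n := ⟨i⟩
  obtain ⟨m, hm⟩ := Finite.exists_min w
  have hle : w m ≤ M.mulVec w m :=
    calc w m = ∑ j, M m j * w m := by
          rw [← Finset.sum_mul, Matrix.sum_row_of_mem_rowStochastic hM, one_mul]
      _ ≤ ∑ j, M m j * w j := Finset.sum_le_sum fun j _ =>
          mul_le_mul_of_nonneg_left (hm j) (Matrix.nonneg_of_mem_rowStochastic hM)
  have h0 : 0 ≤ (1 - γ) * w m := by
    linarith [hw m, mul_le_mul_of_nonneg_left hle hγ.1.le]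
  exact (nonneg_of_mul_nonneg_right h0 (sub_pos.2 hγ.2)).trans (hm i)

/-- Improving the Bellman backup of `value γ c π p` in every state improves the value. -/
lemma value_le_value_of_dotAS_ghat_le (hγ : γ ∈ Set.Ioo (0 : ℝ) 1) (hπ : IsPolicy π)
    {q : Fin S → Fin A → Fin S → ℝ} (hp : IsKernel p) (hq : IsKernel q)
    (hle : ∀ s, dotAS (ghat γ c π p s) (p s) ≤ dotAS (ghat γ c π p s) (q s)) (s : Fin S) :
    value γ c π p s ≤ value γ c π q s := by
  refine sub_nonneg.1 (nonneg_of_mul_mulVec_le (Pmat_mem_rowStochastic hπ hq) hγ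
    (w := value γ c π q - value γ c π p) (fun i => ?_) s)
  have hi := hle i
  rw [dotAS_ghat, dotAS_ghat, ← value_eq_cvec_add hγ hπ hp] at hi
  rw [Matrix.mulVec_sub, Pi.sub_apply, Pi.sub_apply]
  linarith [value_eq_cvec_add (c := c) hγ hπ hq i]

end Value

/-- Ascent property of TMA: the three-point inequality for each mirror ascent
step, and monotonicity of the return along the TMA iterates. -/
theorem tma_ascent_property
    {S A : ℕ} (hS : 0 < S) (hA : 0 < A)
    (γ : ℝ) (hγ : γ ∈ Set.Ioo (0 : ℝ) 1)
    (c : Fin S → Fin A → Fin S → ℝ)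
    (hc : ∀ s a s', c s a s' ∈ Set.Icc (0 : ℝ) 1)
    -- s-rectangular ambiguity set
    (Ps : Fin S → Set (Fin A → Fin S → ℝ))
    (hPsne : ∀ s, (Ps s).Nonempty) (hPscpt : ∀ s, IsCompact (Ps s))
    (hPsconv : ∀ s, Convex ℝ (Ps s))
    (hPssub : ∀ s, ∀ x ∈ Ps s, ∀ a, x a ∈ stdSimplex ℝ (Fin S))
    -- fixed policy
    (π : Fin S → Fin A → ℝ) (hπ : IsPolicy π)
    -- Bregman generating function
    (h : (Fin A → Fin S → ℝ) → ℝ) (hh : ContDiff ℝ 1 h)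
    (hhconv : StrictConvexOn ℝ Set.univ h)
    -- TMA iterates
    (p : ℕ → Fin S → Fin A → Fin S → ℝ) (hp : ∀ t s, p t s ∈ Ps s)
    (β : ℕ → ℝ) (hβ : ∀ t, 0 < β t)
    (hupd : ∀ t s, ∀ x ∈ Ps s,
      β t * dotAS (ghat γ c π (p t) s) x - breg h x (p t s) ≤
        β t * dotAS (ghat γ c π (p t) s) (p (t + 1) s) -
          breg h (p (t + 1) s) (p t s)) :
    (∀ t s, ∀ y ∈ Ps s,
      β t * dotAS (ghat γ c π (p t) s) (y - p (t + 1) s) +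
          breg h (p (t + 1) s) (p t s) ≤
        breg h y (p t s) - breg h y (p (t + 1) s)) ∧
    (∀ t : ℕ, ∀ ρ ∈ stdSimplex ℝ (Fin S),
      J γ c ρ π (p t) ≤ J γ c ρ π (p (t + 1))) := by
  have hdiff : Differentiable ℝ h := hh.differentiable one_ne_zero
  refine ⟨fun t s y hy => ?_, fun t ρ hρ => ?_⟩
  · have := breg_three_point hdiff (hPsconv s) (β t • dotASL (ghat γ c π (p t) s))
      (hp (t + 1) s) hy (z := p t s) (by simpa using hupd t s)
    simpa using this
  · have hker : ∀ t, IsKernel (p t) := fun t s => hPssub s _ (hp t s)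
    refine Finset.sum_le_sum fun s _ => mul_le_mul_of_nonneg_left ?_ (hρ.1 s)
    refine value_le_value_of_dotAS_ghat_le hγ hπ (hker t) (hker (t + 1)) (fun s => ?_) s
    have hstep := hupd t s _ (hp t s)
    rw [breg_self] at hstep
    have hnonneg := breg_nonneg hhconv.convexOn (hdiff (p t s)) (p (t + 1) s)
    exact le_of_mul_le_mul_left (by linarith) (hβ t)

end RMDPStmt
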